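/- arXiv:1907.13183 — 2 statements merged into one kernel-verified Lean document; each statement's English description precedes it below -/
import Mathlib

section
/- Let f : Circle × Circle → ℝ be defined by f(z, w) = Re(z). Then for every y ∈ ℝ the fiber f⁻¹({y}) has at most 2 connected components. -/
theorem torus_fiber_aux (y : ℝ) (a b : ↥{p : Circle × Circle | (p.1 : ℂ).re = y})
    (h : ((a.1.1 : Circle) : ℂ).im = ((b.1.1 : Circle) : ℂ).im) :
    (a : ConnectedComponents ↥{p : Circle × Circle | (p.1 : ℂ).re = y}) = b := by
  obtain ⟨⟨z, w⟩, ha⟩ := a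
  obtain ⟨⟨z', w'⟩, hb⟩ := b
  have hz : z = z' := by
    apply Circle.ext
    apply Complex.ext
    · exact Eq.trans ha (Eq.symm hb)
    · exact h
  subst hz
  let g : Circle → ↥{p : Circle × Circle | (p.1 : ℂ).re = y} := fun u => ⟨(z, u), ha⟩
  have hg : Continuous g := by
    apply Continuous.subtype_mk
    fun_prop
  have hc : IsPreconnected (Set.range g) := isPreconnected_range hg
  rw [ConnectedComponents.coe_eq_coe']
  exact hc.subset_connectedComponent (Set.mem_range_self w') (Set.mem_range_self w)

theorem torus_fiber_im_sq (y : ℝ) (a : ↥{p : Circle × Circle | (p.1 : ℂ).re = y}) :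
    ((a.1.1 : Circle) : ℂ).im ^ 2 = 1 - y ^ 2 := by
  have h1 := Circle.normSq_coe a.1.1
  have h2 : ((a.1.1 : Circle) : ℂ).re = y := a.2
  rw [Complex.normSq_apply, h2] at h1
  linarith

/-- Every fiber of the height function `(z, w) ↦ Re z` on the torus `S¹ × S¹` has at most
two connected components. -/
theorem torus_height_fiber_at_most_two_components (y : ℝ) :
    ∀ c₁ c₂ c₃ : ConnectedComponents ↥{p : Circle × Circle | (p.1 : ℂ).re = y},
      c₁ = c₂ ∨ c₁ = c₃ ∨ c₂ = c₃ := by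
  intro c₁ c₂ c₃
  obtain ⟨a, rfl⟩ := ConnectedComponents.surjective_coe c₁
  obtain ⟨b, rfl⟩ := ConnectedComponents.surjective_coe c₂
  obtain ⟨c, rfl⟩ := ConnectedComponents.surjective_coe c₃
  have ha := torus_fiber_im_sq y a
  have hb := torus_fiber_im_sq y b
  have hc := torus_fiber_im_sq y c
  rcases sq_eq_sq_iff_eq_or_eq_neg.mp (ha.trans hb.symm) with h | h
  · exact Or.inl (torus_fiber_aux y a b h)
  rcases sq_eq_sq_iff_eq_or_eq_neg.mp (ha.trans hc.symm) with h' | h'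
  · exact Or.inr (Or.inl (torus_fiber_aux y a c h'))
  · exact Or.inr (Or.inr (torus_fiber_aux y b c (by linarith)))
end

section
/- Let S³ = {x ∈ EuclideanSpace ℝ (Fin 4) : ‖x‖ = 1} be the unit 3-sphere and let f : S³ → ℝ² be given by f(x) = (x 0, x 1) (the first two coordinates). Then for every p ∈ ℝ² the fiber f⁻¹({p}) = {x ∈ S³ : x 0 = p 0 and x 1 = p 1} is a preconnected subset of S³. -/
/-- Every fiber of the projection of the unit 3-sphere onto its first two coordinates is
a preconnected subset of the sphere. -/
theorem sphere3_first_two_coords_fiber_preconnected (p : EuclideanSpace ℝ (Fin 2)) :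
    IsPreconnected
      {x : {v : EuclideanSpace ℝ (Fin 4) // ‖v‖ = 1} |
        (x : EuclideanSpace ℝ (Fin 4)) 0 = p 0 ∧ (x : EuclideanSpace ℝ (Fin 4)) 1 = p 1} := by
  have key : ∀ v : EuclideanSpace ℝ (Fin 4),
      ‖v‖ = 1 ↔ v 0 ^ 2 + v 1 ^ 2 + v 2 ^ 2 + v 3 ^ 2 = 1 := by
    intro v
    have h := EuclideanSpace.real_norm_sq_eq v
    rw [Fin.sum_univ_four] at h
    rw [← h, pow_eq_one_iff_of_nonneg (norm_nonneg v) two_ne_zero]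
  have hi : Topology.IsInducing (Subtype.val : {v : EuclideanSpace ℝ (Fin 4) // ‖v‖ = 1} → _) := ⟨rfl⟩
  rw [← hi.isPreconnected_image]
  by_cases hr : 0 ≤ 1 - p 0 ^ 2 - p 1 ^ 2
  · have hs := Real.sq_sqrt hr
    set r := Real.sqrt (1 - p 0 ^ 2 - p 1 ^ 2) with hrdef
    have hc : Continuous (fun t : ℝ =>
        (!₂[p 0, p 1, r * Real.cos t, r * Real.sin t] : EuclideanSpace ℝ (Fin 4))) := by
      refine (PiLp.continuous_toLp 2 _).comp (continuous_pi fun i => ?_)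
      fin_cases i <;> simp <;> fun_prop
    convert isPreconnected_range hc using 1
    ext v
    constructor
    · rintro ⟨⟨w, hw⟩, ⟨h0, h1⟩, rfl⟩
      simp only at h0 h1 ⊢
      rw [key, h0, h1] at hw
      have hn : ‖(⟨w 2, w 3⟩ : ℂ)‖ = r := by
        rw [Complex.norm_def, hrdef, Complex.normSq_mk]
        congr 1
        linarith
      have hcos := Complex.norm_mul_cos_arg (⟨w 2, w 3⟩ : ℂ)
      have hsin := Complex.norm_mul_sin_arg (⟨w 2, w 3⟩ : ℂ)
      rw [hn] at hcos hsin
      refine ⟨Complex.arg ⟨w 2, w 3⟩, ?_⟩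
      ext i
      fin_cases i
      · simpa using h0.symm
      · simpa using h1.symm
      · simpa using hcos
      · simpa using hsin
    · rintro ⟨t, rfl⟩
      refine ⟨⟨_, (key _).2 ?_⟩, ⟨?_, ?_⟩, rfl⟩
      · simp
        linear_combination hs + r ^ 2 * Real.sin_sq_add_cos_sq t
      · simp
      · simp
  · convert isPreconnected_empty
    rw [Set.eq_empty_iff_forall_notMem]
    rintro v ⟨⟨w, hw⟩, ⟨h0, h1⟩, rfl⟩
    simp only at h0 h1
    rw [key, h0, h1] at hw
    nlinarith [sq_nonneg (w 2), sq_nonneg (w 3)]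
end
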